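/- Let α, c, N be real numbers with α+c−N ∉ {−1,−2,−3,…} and such that 2m+α+c−N−1 ≠ 0 and 2m+α+c−N−2 ≠ 0 for every integer m ≥ 1. Set θ_n = (n+1)(n+α+c−N−1) and σ_n = 2n+α+c−N−2, define u_j(n) = (n)_j·(−n−α−c+N+2)_j, and polynomials r_0 = 1 and r_j(x) = (−1)^j ∏_{i=0}^{j−1}(x + i(α+c−N−2−i)) for j ≥ 1. Let k ≥ 1 and let w_0, …, w_k be real numbers with w_k ≠ 0; put P₂ = Σ_{j=0}^{k} w_j·r_j and P₁(x) = (α+c−N)·P₂(x) + 2(x−α−c+N+1)·Σ_{j=0}^{k} (w_j/(j+1))·r_j(x). Define γ_n = Σ_{j=0}^{k} w_j·u_j(n) and assume γ_n ≠ 0 for all integers n ≥ 1. Define β_n = [n(N−n)(n+α−N)/((2n+α+c−N−1)(2n+α+c−N−2))]·γ_{n+1}/γ_n for n ≥ 1, λ_n = (σ_n·γ_n + P₁(θ_{n−1}))/2 for n ≥ 1, λ_0 = (P₁(θ_0) − σ_1·P₂(θ_0))/2, and polynomials q_0 = 1, q_n = h_n^{α,c,N} + β_n·h_{n−1}^{α,c,N}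 for n ≥ 1. Let T be the linear endomorphism of ℝ[X] given by (Tf)(x) = −((α+c−N)/2)·f(x) + (−x+N−1)·(f(x+1) − f(x)), and let D = (1/2)·P₁(D_{α,c,N}) + T ∘ P₂(D_{α,c,N}). Then D(q_n) = λ_n·q_n for all n ≥ 0. -/

import Mathlib

open Polynomial

/-- The Pochhammer symbol `(y)_j = y(y+1)⋯(y+j-1)` for a real `y`. -/
noncomputable def poch (y : ℝ) (j : ℕ) : ℝ := ∏ i ∈ Finset.range j, (y + i)

/-- The monic Hahn polynomial
`h_n^{α,c,N}(x) = ∑_{j=0}^n (-n)_j (-x)_j (1-N+j)_{n-j} (c+j)_{n-j} / ((n+α+c-N+j)_{n-j} j!)`. -/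
noncomputable def hahn (α c N : ℝ) (n : ℕ) : ℝ[X] :=
  ∑ j ∈ Finset.range (n+1),
    C (poch (-(n : ℝ)) j * poch (1 - N + j) (n-j) * poch (c + j) (n-j)
        / (poch ((n : ℝ) + α + c - N + j) (n-j) * (j.factorial : ℝ)))
      * ∏ i ∈ Finset.range j, (-X + C (i : ℝ))

/-- The polynomial `r_j(x) = (-1)^j ∏_{i=0}^{j-1} (x + i(α+c-N-2-i))` (`r_0 = 1`). -/
noncomputable def hahnR (α c N : ℝ) (j : ℕ) : ℝ[X] :=
  C ((-1:ℝ)^j) * ∏ i ∈ Finset.range j, (X + C ((i : ℝ) * (α + c - N - 2 - i)))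

/-- The number `u_j(n) = (n)_j (-n-α-c+N+2)_j`. -/
noncomputable def hahnU (α c N : ℝ) (j n : ℕ) : ℝ :=
  poch (n : ℝ) j * poch (-(n : ℝ) - α - c + N + 2) j

theorem poch_succ (y : ℝ) (j : ℕ) : poch y (j + 1) = poch y j * (y + j) :=
  Finset.prod_range_succ _ _

theorem poch_succ_left (y : ℝ) (j : ℕ) : poch y (j + 1) = y * poch (y + 1) j := by
  simp only [poch, Finset.prod_range_succ', Nat.cast_add, Nat.cast_one, Nat.cast_zero, add_zero]
  rw [mul_comm]
  congr 1
  exact Finset.prod_congr rfl fun i _ => by ring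

theorem poch_ne_zero {y : ℝ} (j : ℕ) (h : ∀ i : ℕ, y + i ≠ 0) : poch y j ≠ 0 :=
  Finset.prod_ne_zero_iff.2 fun i _ => h i

theorem poch_neg_eq_zero {n j : ℕ} (h : n < j) : poch (-(n : ℝ)) j = 0 :=
  Finset.prod_eq_zero (Finset.mem_range.2 h) (by simp)

/-- The polynomial `(-x)_j`. -/
noncomputable def negPoch (j : ℕ) : ℝ[X] := ∏ i ∈ Finset.range j, (-X + C (i : ℝ))

theorem negPoch_eval (j : ℕ) (x : ℝ) : (negPoch j).eval x = poch (-x) j := by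
  simp [negPoch, poch, eval_prod]

/-- The coefficient of `(-x)_j` in the monic Hahn polynomial of degree `n`. -/
noncomputable def hahnCoeff (α c N : ℝ) (n j : ℕ) : ℝ :=
  poch (-(n : ℝ)) j * poch (1 - N + j) (n-j) * poch (c + j) (n-j)
    / (poch ((n : ℝ) + α + c - N + j) (n-j) * (j.factorial : ℝ))

theorem hahn_eq_sum (α c N : ℝ) (n : ℕ) :
    hahn α c N n = ∑ j ∈ Finset.range (n+1), hahnCoeff α c N n j • negPoch j := by
  simp [hahn, hahnCoeff, negPoch, smul_eq_C_mul]

theorem hahnCoeff_eq_zero {α c N : ℝ} {n j : ℕ} (h : n < j) : hahnCoeff α c N n j = 0 := by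
  simp [hahnCoeff, poch_neg_eq_zero h]

/-- `hahn` as a sum over a range longer than necessary. -/
theorem hahn_eq_sum_succ (α c N : ℝ) (n : ℕ) :
    hahn α c N n = ∑ j ∈ Finset.range (n+2), hahnCoeff α c N n j • negPoch j := by
  rw [hahn_eq_sum, Finset.sum_range_succ _ (n+1), hahnCoeff_eq_zero (Nat.lt_succ_self n),
    zero_smul, add_zero]

theorem add_natCast_ne_zero {α c N : ℝ} (h1 : ∀ m : ℕ, α + c - N ≠ -((m : ℝ) + 1)) (m : ℕ) :
    (m : ℝ) + 1 + α + c - N ≠ 0 := fun h => h1 m (by linarith)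

/-- The two-term recurrence in `j` of the Hahn coefficients. -/
theorem hahnCoeff_recurrence {α c N : ℝ} (h1 : ∀ m : ℕ, α + c - N ≠ -((m : ℝ) + 1)) {n j : ℕ}
    (hj : j ≤ n) :
    ((j : ℝ) + 1) * (N - j - 1) * (c + j) * hahnCoeff α c N n (j+1) =
      ((n : ℝ) - j) * (n + α + c - N + j) * hahnCoeff α c N n j := by
  obtain rfl | hlt := hj.eq_or_lt
  · simp [hahnCoeff_eq_zero]
  obtain ⟨d, rfl⟩ := Nat.exists_eq_add_of_lt hlt
  have e1 : j + d + 1 - j = d + 1 := by omega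
  have e2 : j + d + 1 - (j + 1) = d := by omega
  simp only [hahnCoeff, e1, e2]
  rw [poch_succ, poch_succ_left (1 - N + j), poch_succ_left (c + j),
    poch_succ_left (_ + (j : ℝ)), Nat.factorial_succ]
  have hd : ((j + d + 1 : ℕ) : ℝ) + α + c - N + j ≠ 0 := by
    have := add_natCast_ne_zero h1 (j + d + j)
    push_cast at this ⊢
    intro h; exact this (by linarith)
  have hQ : poch (((j + d + 1 : ℕ) : ℝ) + α + c - N + j + 1) d ≠ 0 :=
    poch_ne_zero _ fun i => by
      have := add_natCast_ne_zero h1 (j + d + j + 1 + i)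
      push_cast at this ⊢
      intro h; exact this (by linarith)
  have hf : (j.factorial : ℝ) ≠ 0 := by exact_mod_cast j.factorial_ne_zero
  have hj1 : (j : ℝ) + 1 ≠ 0 := by positivity
  push_cast at hd hQ ⊢
  simp only [← add_assoc] at hd hQ ⊢
  generalize poch (-((j : ℝ) + d + 1)) j = G
  generalize poch (1 - N + j + 1) d = p
  generalize poch (c + j + 1) d = r
  generalize hQd : poch ((j : ℝ) + d + 1 + α + c - N + j + 1) d = Q at hQ ⊢
  field_simp
  ring

/-- The ratio `β_n / (γ_{n+1} / γ_n)`, shifted to `n + 1`. -/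
noncomputable def hahnEps (α c N : ℝ) (n : ℕ) : ℝ :=
  ((n : ℝ) + 1) * (N - (n + 1)) * ((n : ℝ) + 1 + α - N)
    / ((2*((n : ℝ) + 1) + α + c - N - 1) * (2*((n : ℝ) + 1) + α + c - N - 2))

/-- A contiguous relation between the Hahn coefficients of degrees `n + 1` and `n`. -/
theorem hahnCoeff_contiguous {α c N : ℝ} (h1 : ∀ m : ℕ, α + c - N ≠ -((m : ℝ) + 1))
    (h2 : ∀ m : ℕ, 1 ≤ m → 2*(m : ℝ) + α + c - N - 1 ≠ 0)
    (h3 : ∀ m : ℕ, 1 ≤ m → 2*(m : ℝ) + α + c - N - 2 ≠ 0) {n j : ℕ} (hj : j ≤ n + 1) :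
    ((n : ℝ) + 1 - j) * hahnCoeff α c N (n+1) j
        - (n + α + c - N + j) * hahnEps α c N n * hahnCoeff α c N n j =
      ((j : ℝ) + 1) * (N - j - 1)
        * (hahnCoeff α c N (n+1) (j+1) + hahnEps α c N n * hahnCoeff α c N n (j+1)) := by
  obtain rfl | hlt := hj.eq_or_lt
  · simp [hahnCoeff_eq_zero]
  have hn2 := h2 (n+1) (by omega)
  have hn3 := h3 (n+1) (by omega)
  have hf : (j.factorial : ℝ) ≠ 0 := by exact_mod_cast j.factorial_ne_zero
  have hj1 : (j : ℝ) + 1 ≠ 0 := by positivity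
  have hG : poch (-((n : ℝ) + 1)) j * ((n : ℝ) + 1 - j) = ((n : ℝ) + 1) * poch (-(n : ℝ)) j := by
    have := (poch_succ (-((n : ℝ) + 1)) j).symm.trans (poch_succ_left _ _)
    rw [show -((n : ℝ) + 1) + 1 = -(n : ℝ) by ring] at this
    linear_combination -this
  have hG' : poch (-((n : ℝ) + 1)) (j+1) = -((n : ℝ) + 1) * poch (-(n : ℝ)) j := by
    rw [poch_succ_left, show -((n : ℝ) + 1) + 1 = -(n : ℝ) by ring]
  obtain rfl | hlt := (Nat.lt_succ_iff.1 hlt).eq_or_lt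
  · have e1 : j + 1 - j = 1 := by omega
    rw [hahnCoeff_eq_zero (Nat.lt_succ_self j)]
    simp only [hahnCoeff, hahnEps, e1, Nat.sub_self, Nat.factorial_succ]
    push_cast at hn2 hn3 ⊢
    rw [hG']
    have hG1 : poch (-((j : ℝ) + 1)) j = ((j : ℝ) + 1) * poch (-(j : ℝ)) j := by
      linear_combination hG
    rw [hG1]
    simp only [poch, Finset.prod_range_one, Finset.prod_range_zero, Nat.cast_zero, add_zero]
    obtain ⟨z, hz⟩ : ∃ z, z = 2 * (j : ℝ) + α + c - N := ⟨_, rfl⟩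
    rw [show 2 * ((j : ℝ) + 1) + α + c - N - 1 = z + 1 by rw [hz]; ring] at hn2 ⊢
    rw [show 2 * ((j : ℝ) + 1) + α + c - N - 2 = z by rw [hz]; ring] at hn3 ⊢
    rw [show (j : ℝ) + 1 + α + c - N + j = z + 1 by rw [hz]; ring,
      show (j : ℝ) + α + c - N + j = z by rw [hz]; ring]
    obtain rfl : α = z - 2 * j - c + N := by rw [hz]; ring
    generalize ∏ i ∈ Finset.range j, (-(j : ℝ) + i) = G
    field_simp
    ring
  obtain ⟨d, rfl⟩ := Nat.exists_eq_add_of_lt hlt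
  have e1 : j + d + 1 + 1 - j = d + 1 + 1 := by omega
  have e2 : j + d + 1 + 1 - (j + 1) = d + 1 := by omega
  have e3 : j + d + 1 - j = d + 1 := by omega
  have e4 : j + d + 1 - (j + 1) = d := by omega
  have hd : ((j + d + 1 : ℕ) : ℝ) + α + c - N + j ≠ 0 := by
    have := add_natCast_ne_zero h1 (j + d + j)
    push_cast at this ⊢
    intro h; exact this (by linarith)
  have hd' : ((j + d + 1 : ℕ) : ℝ) + α + c - N + j + 1 ≠ 0 := by
    have := add_natCast_ne_zero h1 (j + d + j + 1)
    push_cast at this ⊢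
    intro h; exact this (by linarith)
  have hnj : ((j + d + 1 : ℕ) : ℝ) + 1 - j ≠ 0 := by
    push_cast; ring_nf; positivity
  have hQ : poch (((j + d + 1 : ℕ) : ℝ) + α + c - N + j + 1) d ≠ 0 :=
    poch_ne_zero _ fun i => by
      have := add_natCast_ne_zero h1 (j + d + j + 1 + i)
      push_cast at this ⊢
      intro h; exact this (by linarith)
  set Q := poch (((j + d + 1 : ℕ) : ℝ) + α + c - N + j + 1) d with hQdef
  have q1 : poch (((j + d + 1 + 1 : ℕ) : ℝ) + α + c - N + j) (d+1+1) =
      Q * (2*((j + d + 1 + 1 : ℕ) : ℝ) + α + c - N - 2)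
        * (2*((j + d + 1 + 1 : ℕ) : ℝ) + α + c - N - 1) := by
    rw [poch_succ, poch_succ, hQdef]
    push_cast
    rw [show (j : ℝ) + d + 1 + 1 + α + c - N + j = j + d + 1 + α + c - N + j + 1 by ring]
    ring
  have q2 : poch (((j + d + 1 + 1 : ℕ) : ℝ) + α + c - N + (j + 1 : ℕ)) (d+1) =
      Q * (2*((j + d + 1 + 1 : ℕ) : ℝ) + α + c - N - 2)
        * (2*((j + d + 1 + 1 : ℕ) : ℝ) + α + c - N - 1)
        / (((j + d + 1 : ℕ) : ℝ) + α + c - N + j + 1) := by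
    rw [eq_div_iff hd', ← q1, poch_succ_left _ (d+1)]
    push_cast
    rw [show (j : ℝ) + d + 1 + 1 + α + c - N + j + 1 = j + d + 1 + 1 + α + c - N + (j + 1) by ring]
    ring
  have q3 : poch (((j + d + 1 : ℕ) : ℝ) + α + c - N + j) (d+1) =
      (((j + d + 1 : ℕ) : ℝ) + α + c - N + j) * Q := poch_succ_left _ _
  have q4 : poch (((j + d + 1 : ℕ) : ℝ) + α + c - N + (j + 1 : ℕ)) d = Q := by
    rw [hQdef]; push_cast; congr 1; ring
  have hshift : ∀ y : ℝ, poch (y + j) (d+1+1) = (y + j) * (poch (y + j + 1) d * (y + j + 1 + d)) :=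
    fun y => by rw [poch_succ_left, poch_succ]
  have hshift' : ∀ y : ℝ, poch (y + (j + 1 : ℕ)) (d+1) = poch (y + j + 1) d * (y + j + 1 + d) :=
    fun y => by rw [poch_succ]; push_cast; rw [← add_assoc]
  have hshift'' : ∀ y : ℝ, poch (y + (j + 1 : ℕ)) d = poch (y + j + 1) d :=
    fun y => by push_cast; rw [← add_assoc]
  simp only [hahnCoeff, hahnEps, e1, e2, e3, e4, q1, q2, q3, q4, hshift, hshift', hshift'',
    poch_succ_left (1 - N + (j : ℝ)), poch_succ_left (c + (j : ℝ)), Nat.factorial_succ]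
  rw [poch_succ (-((j + d + 1 : ℕ) : ℝ)) j]
  rw [Nat.cast_succ (j + d + 1), hG', eq_div_of_mul_eq hnj hG]
  generalize poch (-((j + d + 1 : ℕ) : ℝ)) j = G
  generalize poch (1 - N + j + 1) d = p
  generalize poch (c + j + 1) d = r
  clear_value Q
  clear hG hG' q1 q2 q3 q4
  push_cast at *
  field_simp
  ring

theorem map_negPoch_sum {L : Module.End ℝ ℝ[X]} {μ ν : ℕ → ℝ}
    (h0 : L (negPoch 0) = μ 0 • negPoch 0)
    (hs : ∀ j, L (negPoch (j+1)) = μ (j+1) • negPoch (j+1) + ν j • negPoch j)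
    (a : ℕ → ℝ) (m : ℕ) (ha : a (m+1) = 0) :
    L (∑ j ∈ Finset.range (m+1), a j • negPoch j) =
      ∑ j ∈ Finset.range (m+1), (μ j * a j + ν j * a (j+1)) • negPoch j := by
  have key : ∀ m, L (∑ j ∈ Finset.range (m+1), a j • negPoch j) + (ν m * a (m+1)) • negPoch m =
      ∑ j ∈ Finset.range (m+1), (μ j * a j + ν j * a (j+1)) • negPoch j := by
    intro m
    induction m with
    | zero => simp [h0, add_smul, smul_smul, mul_comm]
    | succ m ih =>
      rw [Finset.sum_range_succ, Finset.sum_range_succ _ (m+1), ← ih, map_add, map_smul, hs]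
      module
  simpa [ha] using key m

section Operators

variable {α c N : ℝ} {Dh T : Module.End ℝ ℝ[X]}

theorem hahnOperator_negPoch_zero
    (hDh : ∀ f : ℝ[X], ∀ x : ℝ, (Dh f).eval x =
      x*(x-α) * f.eval (x-1) + (x+c)*(x-N+1) * f.eval (x+1)
        + (-2*x^2 + (α-c+N-1)*x + α + N*(c-1) - 1) * f.eval x) :
    Dh (negPoch 0) = (α + c - N - 1) • negPoch 0 := by
  refine Polynomial.funext fun x => ?_
  rw [hDh]
  simp [negPoch]
  ring

theorem hahnOperator_negPoch_succ
    (hDh : ∀ f : ℝ[X], ∀ x : ℝ, (Dh f).eval x =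
      x*(x-α) * f.eval (x-1) + (x+c)*(x-N+1) * f.eval (x+1)
        + (-2*x^2 + (α-c+N-1)*x + α + N*(c-1) - 1) * f.eval x) (j : ℕ) :
    Dh (negPoch (j+1)) = (((j : ℝ) + 2) * (j + α + c - N)) • negPoch (j+1)
      + (((j : ℝ) + 1) * (N - j - 1) * (c + j)) • negPoch j := by
  refine Polynomial.funext fun x => ?_
  rw [hDh]
  simp only [eval_add, eval_smul, negPoch_eval, smul_eq_mul]
  have e1 : x * poch (-(x-1)) (j+1) = (x - (j + 1)) * poch (-x) (j+1) := by
    have := (poch_succ (-x) (j+1)).symm.trans (poch_succ_left _ _)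
    rw [show -x + 1 = -(x - 1) by ring] at this
    push_cast at this
    linear_combination this
  have e2 : poch (-(x+1)) (j+1) = -(x+1) * poch (-x) j := by
    rw [poch_succ_left, show -(x + 1) + 1 = -x by ring]
  rw [e2, mul_right_comm x, e1, poch_succ]
  ring

theorem hahn_eigen (h1 : ∀ m : ℕ, α + c - N ≠ -((m : ℝ) + 1))
    (hDh : ∀ f : ℝ[X], ∀ x : ℝ, (Dh f).eval x =
      x*(x-α) * f.eval (x-1) + (x+c)*(x-N+1) * f.eval (x+1)
        + (-2*x^2 + (α-c+N-1)*x + α + N*(c-1) - 1) * f.eval x) (n : ℕ) :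
    Dh (hahn α c N n) = (((n : ℝ) + 1) * ((n : ℝ) + α + c - N - 1)) • hahn α c N n := by
  rw [hahn_eq_sum, map_negPoch_sum (μ := fun j => ((j : ℝ) + 1) * (j + α + c - N - 1))
    (ν := fun j => ((j : ℝ) + 1) * (N - j - 1) * (c + j)) _ _ _ _
    (hahnCoeff_eq_zero (Nat.lt_succ_self n)), Finset.smul_sum]
  · refine Finset.sum_congr rfl fun j hj => ?_
    rw [smul_smul]
    congr 1
    rw [hahnCoeff_recurrence h1 (Nat.lt_succ_iff.1 (Finset.mem_range.1 hj))]
    ring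
  · rw [hahnOperator_negPoch_zero hDh]
    simp
  · intro j
    rw [hahnOperator_negPoch_succ hDh]
    push_cast
    congr 2
    ring

theorem aeval_hahn (h1 : ∀ m : ℕ, α + c - N ≠ -((m : ℝ) + 1))
    (hDh : ∀ f : ℝ[X], ∀ x : ℝ, (Dh f).eval x =
      x*(x-α) * f.eval (x-1) + (x+c)*(x-N+1) * f.eval (x+1)
        + (-2*x^2 + (α-c+N-1)*x + α + N*(c-1) - 1) * f.eval x) (P : ℝ[X]) (n : ℕ) :
    aeval Dh P (hahn α c N n) =
      P.eval (((n : ℝ) + 1) * ((n : ℝ) + α + c - N - 1)) • hahn α c N n := by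
  by_cases h : hahn α c N n = 0
  · simp [h]
  · exact Module.End.aeval_apply_of_hasEigenvector
      ⟨Module.End.mem_eigenspace_iff.2 (hahn_eigen h1 hDh n), h⟩

theorem shiftOperator_negPoch_zero
    (hT : ∀ f : ℝ[X], ∀ x : ℝ, (T f).eval x =
      -((α+c-N)/2) * f.eval x + (-x+N-1) * (f.eval (x+1) - f.eval x)) :
    T (negPoch 0) = (-((α+c-N)/2)) • negPoch 0 := by
  refine Polynomial.funext fun x => ?_
  rw [hT]
  simp [negPoch]

theorem shiftOperator_negPoch_succ
    (hT : ∀ f : ℝ[X], ∀ x : ℝ, (T f).eval x =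
      -((α+c-N)/2) * f.eval x + (-x+N-1) * (f.eval (x+1) - f.eval x)) (j : ℕ) :
    T (negPoch (j+1)) = (-((α+c-N)/2) - (j + 1)) • negPoch (j+1)
      + (-((j + 1) * (N - j - 1))) • negPoch j := by
  refine Polynomial.funext fun x => ?_
  rw [hT]
  simp only [eval_add, eval_smul, negPoch_eval, smul_eq_mul]
  have e2 : poch (-(x+1)) (j+1) = -(x+1) * poch (-x) j := by
    rw [poch_succ_left, show -(x + 1) + 1 = -x by ring]
  rw [e2, poch_succ]
  ring

theorem shiftOperator_hahn (h1 : ∀ m : ℕ, α + c - N ≠ -((m : ℝ) + 1))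
    (h2 : ∀ m : ℕ, 1 ≤ m → 2*(m : ℝ) + α + c - N - 1 ≠ 0)
    (h3 : ∀ m : ℕ, 1 ≤ m → 2*(m : ℝ) + α + c - N - 2 ≠ 0)
    (hT : ∀ f : ℝ[X], ∀ x : ℝ, (T f).eval x =
      -((α+c-N)/2) * f.eval x + (-x+N-1) * (f.eval (x+1) - f.eval x)) (n : ℕ) :
    T (hahn α c N (n+1)) + hahnEps α c N n • T (hahn α c N n) =
      (-((2*n + 2 + α + c - N) / 2)) • hahn α c N (n+1)
        + ((2*n + α + c - N) / 2 * hahnEps α c N n) • hahn α c N n := by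
  have h0 := shiftOperator_negPoch_zero hT
  rw [hahn_eq_sum _ _ _ (n+1), hahn_eq_sum_succ _ _ _ n]
  rw [map_negPoch_sum (μ := fun j => -((α+c-N)/2) - j) (ν := fun j => -((j + 1) * (N - j - 1)))
      (by simpa using h0) (by simpa using shiftOperator_negPoch_succ hT) _ (n+1)
      (hahnCoeff_eq_zero (Nat.lt_succ_self (n+1))),
    map_negPoch_sum (μ := fun j => -((α+c-N)/2) - j) (ν := fun j => -((j + 1) * (N - j - 1)))
      (by simpa using h0) (by simpa using shiftOperator_negPoch_succ hT) _ (n+1)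
      (hahnCoeff_eq_zero (by omega)),
    Finset.smul_sum, Finset.smul_sum, Finset.smul_sum, ← Finset.sum_add_distrib,
    ← Finset.sum_add_distrib]
  refine Finset.sum_congr rfl fun j hj => ?_
  simp only [smul_smul, ← add_smul]
  congr 1
  linear_combination
    hahnCoeff_contiguous h1 h2 h3 (Nat.lt_succ_iff.1 (Finset.mem_range.1 hj))

end Operators

theorem hahnR_eval (α c N : ℝ) (j n : ℕ) :
    (hahnR α c N j).eval (((n : ℝ) + 1) * ((n : ℝ) + α + c - N - 1)) = hahnU α c N j (n+1) := by
  have hconst : ((-1 : ℝ)) ^ j = ∏ _i ∈ Finset.range j, (-1 : ℝ) := by simp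
  simp only [hahnR, hahnU, poch, eval_mul, eval_C, eval_prod, eval_add, eval_X]
  rw [hconst, ← Finset.prod_mul_distrib, ← Finset.prod_mul_distrib]
  refine Finset.prod_congr rfl fun i _ => ?_
  push_cast
  ring

theorem hahnU_succ_sub (α c N : ℝ) (j n : ℕ) :
    (n : ℝ) * (n + α + c - N) * hahnU α c N j (n+1)
        - ((n : ℝ) - 1) * (n + α + c - N - 1) * hahnU α c N j n =
      ((j : ℝ) + 1) * (n * hahnU α c N j (n+1) + (n + α + c - N - 1) * hahnU α c N j n) := by
  have e1 : (n : ℝ) * poch (n + 1) j = poch n j * (n + j) :=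
    (poch_succ_left _ _).symm.trans (poch_succ _ _)
  have e2 : (-((n : ℝ) + 1) - α - c + N + 2) * poch (-(n : ℝ) - α - c + N + 2) j =
      poch (-((n : ℝ) + 1) - α - c + N + 2) j * (-((n : ℝ) + 1) - α - c + N + 2 + j) := by
    rw [← poch_succ, poch_succ_left]
    congr 2
    ring
  simp only [hahnU]
  push_cast
  generalize poch ((n : ℝ) + 1) j = A' at *
  generalize poch (n : ℝ) j = A at *
  generalize poch (-((n : ℝ) + 1) - α - c + N + 2) j = B' at *
  generalize poch (-(n : ℝ) - α - c + N + 2) j = B at *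
  linear_combination (n + α + c - N - (j + 1)) * B' * e1 + (n + j) * A * e2

/-- Theorem 7.3 (case `i = 1`): the polynomials `q_n = h_n^{α,c,N} + β_n h_{n-1}^{α,c,N}`
are eigenfunctions of
`D = (1/2) P₁(D_{α,c,N}) + (-(α+c-N)/2 + (-x+N-1)Δ) P₂(D_{α,c,N})`. -/
theorem stmt16 (α c N : ℝ)
    (h1 : ∀ m : ℕ, α + c - N ≠ -((m : ℝ) + 1))
    (h2 : ∀ m : ℕ, 1 ≤ m → 2*(m : ℝ) + α + c - N - 1 ≠ 0)
    (h3 : ∀ m : ℕ, 1 ≤ m → 2*(m : ℝ) + α + c - N - 2 ≠ 0)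
    (θ σ : ℕ → ℝ)
    (hθ : ∀ n : ℕ, θ n = ((n : ℝ) + 1) * ((n : ℝ) + α + c - N - 1))
    (hσ : ∀ n : ℕ, σ n = 2*(n : ℝ) + α + c - N - 2)
    (k : ℕ) (hk : 1 ≤ k) (w : ℕ → ℝ) (hwk : w k ≠ 0)
    (P₁ P₂ : ℝ[X])
    (hP₂ : P₂ = ∑ j ∈ Finset.range (k+1), C (w j) * hahnR α c N j)
    (hP₁ : P₁ = C (α + c - N) * P₂
      + 2 * (X - C (α + c - N - 1))
          * ∑ j ∈ Finset.range (k+1), C (w j / ((j : ℝ) + 1)) * hahnR α c N j)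
    (γ : ℕ → ℝ) (hγ : ∀ n : ℕ, γ n = ∑ j ∈ Finset.range (k+1), w j * hahnU α c N j n)
    (hγnz : ∀ n : ℕ, 1 ≤ n → γ n ≠ 0)
    (β lam : ℕ → ℝ)
    (hβ : ∀ n : ℕ, 1 ≤ n → β n =
      ((n : ℝ)*(N - n)*((n : ℝ) + α - N)
          / ((2*(n : ℝ) + α + c - N - 1)*(2*(n : ℝ) + α + c - N - 2)))
        * (γ (n+1) / γ n))
    (hlam : ∀ n : ℕ, lam (n+1) = (σ (n+1) * γ (n+1) + P₁.eval (θ n)) / 2)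
    (hlam0 : lam 0 = (P₁.eval (θ 0) - σ 1 * P₂.eval (θ 0)) / 2)
    (q : ℕ → ℝ[X]) (hq0 : q 0 = 1)
    (hq : ∀ n : ℕ, q (n+1) = hahn α c N (n+1) + C (β (n+1)) * hahn α c N n)
    (Dh : Module.End ℝ ℝ[X])
    (hDh : ∀ f : ℝ[X], ∀ x : ℝ, (Dh f).eval x =
      x*(x-α) * f.eval (x-1) + (x+c)*(x-N+1) * f.eval (x+1)
        + (-2*x^2 + (α-c+N-1)*x + α + N*(c-1) - 1) * f.eval x)
    (T : Module.End ℝ ℝ[X])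
    (hT : ∀ f : ℝ[X], ∀ x : ℝ, (T f).eval x =
      -((α+c-N)/2) * f.eval x + (-x+N-1) * (f.eval (x+1) - f.eval x))
    (D : Module.End ℝ ℝ[X])
    (hD : D = ((1:ℝ)/2) • aeval Dh P₁ + T * aeval Dh P₂) :
    ∀ n : ℕ, D (q n) = lam n • q n := by
  have hP₂e : ∀ n : ℕ, P₂.eval (θ n) = γ (n+1) := fun n => by
    simp only [hP₂, hγ, hθ, eval_finsetSum, eval_mul, eval_C, hahnR_eval]
  have hP₁e : ∀ n : ℕ, P₁.eval (θ n) = (α + c - N) * γ (n+1)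
      + 2 * (n * (n + α + c - N)) * ∑ j ∈ Finset.range (k+1),
        w j / ((j : ℝ) + 1) * hahnU α c N j (n+1) := fun n => by
    rw [hP₁]
    simp only [eval_add, eval_mul, eval_C, hP₂e, eval_sub, eval_X, eval_finsetSum, eval_ofNat]
    simp only [hθ, hahnR_eval]
    ring
  have hstep : ∀ n : ℕ, P₁.eval (θ (n+1)) - σ (n+2) * γ (n+2) =
      P₁.eval (θ n) + σ (n+1) * γ (n+1) := fun n => by
    have hsum : ((n : ℝ) + 1) * (n + 1 + α + c - N) * ∑ j ∈ Finset.range (k+1),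
          w j / ((j : ℝ) + 1) * hahnU α c N j (n+2)
        - n * (n + α + c - N) * ∑ j ∈ Finset.range (k+1),
          w j / ((j : ℝ) + 1) * hahnU α c N j (n+1)
        = (n + 1) * γ (n+2) + (n + α + c - N) * γ (n+1) := by
      rw [hγ, hγ]
      simp only [Finset.mul_sum]
      rw [← Finset.sum_sub_distrib, ← Finset.sum_add_distrib]
      refine Finset.sum_congr rfl fun j _ => ?_
      have hu := hahnU_succ_sub α c N j (n+1)
      have hj : (j : ℝ) + 1 ≠ 0 := by positivity
      push_cast at hu
      field_simp
      linear_combination w j * hu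
    rw [hP₁e, hP₁e, hσ, hσ]
    push_cast
    linear_combination 2 * hsum
  have hDhahn : ∀ n : ℕ, D (hahn α c N n) =
      (P₁.eval (θ n) / 2) • hahn α c N n + γ (n+1) • T (hahn α c N n) := fun n => by
    rw [hD, LinearMap.add_apply, LinearMap.smul_apply, Module.End.mul_apply,
      aeval_hahn h1 hDh, aeval_hahn h1 hDh, ← hθ, hP₂e, map_smul, smul_smul]
    congr 2
    ring
  rintro (_ | n)
  · have hh : hahn α c N 0 = negPoch 0 := by simp [hahn, negPoch, poch]
    have hq0' : q 0 = negPoch 0 := by simp [hq0, negPoch]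
    rw [hq0', ← hh, hDhahn, hh, shiftOperator_negPoch_zero hT, hlam0, hP₂e, hσ, smul_smul,
      ← add_smul]
    congr 1
    push_cast
    ring
  · have hb : β (n+1) * γ (n+1) = hahnEps α c N n * γ (n+2) := by
      have := hγnz (n+1) (by omega)
      rw [hβ _ (by omega), hahnEps]
      push_cast
      rw [mul_assoc, div_mul_cancel₀ _ this]
    have hl : lam (n+1) = (P₁.eval (θ (n+1)) - σ (n+2) * γ (n+2)) / 2 := by
      rw [hlam, hstep]; ring
    have hs := shiftOperator_hahn h1 h2 h3 hT n
    rw [hq, ← smul_eq_C_mul, map_add, map_smul, hDhahn, hDhahn, smul_add, smul_smul, smul_smul,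
      hb, smul_add, smul_smul]
    have hT1 := eq_sub_of_add_eq hs
    rw [show n + 1 + 1 = n + 2 from rfl, hT1]
    have c1 : P₁.eval (θ (n+1)) / 2 - γ (n+2) * ((2*n + 2 + α + c - N) / 2) = lam (n+1) := by
      rw [hl, hσ]; push_cast; ring
    have c2 : β (n+1) * (P₁.eval (θ n) / 2)
        + γ (n+2) * ((2*n + α + c - N) / 2 * hahnEps α c N n) = lam (n+1) * β (n+1) := by
      rw [hlam, hσ]; push_cast; linear_combination (-(2*n + α + c - N) / 2) * hb
    rw [← c2, ← c1]
    module
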